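/- arXiv:2212.03281 — 2 statements merged into one kernel-verified Lean document; each statement's English description precedes it below -/
import Mathlib

section
/- Let n ≥ 1, let α ∈ (0,1), and let S_1, …, S_{n+1} be exchangeable real-valued random variables. Let Q := Q(1−α, {S_1, …, S_n} ∪ {+∞}) be the empirical (1−α)-quantile of the multiset consisting of the first n scores together with +∞. Then P[S_{n+1} ≤ Q] ≥ 1−α. -/
open MeasureTheory

/-- The empirical `(1-α)`-quantile of a finite multiset of extended reals:
`Q(1-α, S) := inf { s* : (1/|S|)·#{ s ∈ S : s ≤ s* } ≥ 1-α }`. -/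
noncomputable def empQuantile (α : ℝ) (S : Multiset EReal) : EReal :=
  sInf {q : EReal | 1 - α ≤ ((S.filter (fun s => s ≤ q)).card : ℝ) / (S.card : ℝ)}

/-- The number of coordinates of `x` that are strictly smaller than the `j`-th one. -/
noncomputable def strictRank {ι : Type*} [Fintype ι] (x : ι → ℝ) (j : ι) : ℕ :=
  (Finset.univ.filter fun i => x i < x j).card

theorem strictRank_comp_perm {ι : Type*} [Fintype ι] (x : ι → ℝ) (σ : Equiv.Perm ι) (j : ι) :
    strictRank (fun i => x (σ i)) j = strictRank x (σ j) :=
  Finset.card_equiv σ (by simp)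

theorem measurable_strictRank {ι : Type*} [Fintype ι] (j : ι) :
    Measurable fun x : ι → ℝ => strictRank x j := by
  simp only [strictRank, Finset.card_filter]
  exact Finset.measurable_sum _ fun i _ => Measurable.ite
    (measurableSet_lt (measurable_pi_apply i) (measurable_pi_apply j))
    measurable_const measurable_const

/-- At least `t` indices have strict rank below `t`. -/
theorem le_card_strictRank_lt {ι : Type*} [Fintype ι] (x : ι → ℝ) {t : ℝ}
    (ht : t ≤ Fintype.card ι) :
    t ≤ ((Finset.univ.filter fun j => (strictRank x j : ℝ) < t).card : ℝ) := by
  rcases (Finset.univ.filter fun j => t ≤ (strictRank x j : ℝ)).eq_empty_or_nonempty with h | h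
  · have h_all : ∀ j, (strictRank x j : ℝ) < t := by
      simpa [Finset.filter_eq_empty_iff] using h
    simpa [h_all] using ht
  · obtain ⟨j, hj, hmin⟩ := Finset.exists_min_image _ x h
    simp only [Finset.mem_filter, Finset.mem_univ, true_and] at hj hmin
    refine hj.trans (Nat.cast_le.2 (Finset.card_le_card fun i hi => ?_))
    simp only [Finset.mem_filter, Finset.mem_univ, true_and] at hi ⊢
    by_contra! hc
    exact (hmin i hc).not_gt hi

/-- A score whose strict rank is below `(1 - α) (n + 1)` does not exceed the empirical quantile
of the other scores together with `⊤`. -/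
theorem le_empQuantile_of_strictRank_lt {n : ℕ} {α : ℝ} (x : Fin (n + 1) → ℝ)
    (hx : (strictRank x (Fin.last n) : ℝ) < (1 - α) * (n + 1)) :
    (x (Fin.last n) : EReal) ≤ empQuantile α
      ((Finset.univ.val.map fun i : Fin n => ((x i.castSucc : ℝ) : EReal)) + {⊤}) := by
  refine le_sInf fun q hq => ?_
  by_contra! hlt
  have h_top : ¬ (⊤ : EReal) ≤ q := fun h =>
    (hlt.trans (EReal.coe_lt_top _)).not_ge h
  rw [Set.mem_ofPred_eq, Multiset.filter_add, Multiset.filter_singleton, if_neg h_top,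
    Multiset.filter_map, le_div_iff₀ (by simp; positivity)] at hq
  simp only [Multiset.card_add, Multiset.card_map, Multiset.card_singleton, Finset.card_val,
    Finset.card_univ, Fintype.card_fin, Multiset.empty_eq_zero, add_zero,
    Nat.cast_add, Nat.cast_one] at hq
  refine (hq.trans (Nat.cast_le.2 ?_)).not_gt hx
  change (Finset.univ.filter fun i : Fin n => ((x i.castSucc : ℝ) : EReal) ≤ q).card ≤ _
  refine Finset.card_le_card_of_injOn Fin.castSucc (fun i hi => ?_)
    (Fin.castSucc_injective n).injOn
  simp only [Finset.coe_filter, Finset.mem_univ, true_and, Set.mem_ofPred_eq] at hi ⊢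
  exact EReal.coe_lt_coe_iff.1 (hi.trans_lt hlt)

/-- If the events `E j` all have the same probability and every outcome lies in at least `t` of
them, then `t` is at most the number of events times their common probability. -/
theorem ofReal_le_card_mul_measure {Ω ι : Type*} [MeasurableSpace Ω] [Fintype ι]
    (P : Measure Ω) [IsProbabilityMeasure P] {E : ι → Set Ω} (hE : ∀ j, MeasurableSet (E j))
    {p : ENNReal} (hp : ∀ j, P (E j) = p) {t : ℝ}
    (ht : ∀ ω, ENNReal.ofReal t ≤ ∑ j, (E j).indicator 1 ω) :
    ENNReal.ofReal t ≤ Fintype.card ι * p :=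
  calc ENNReal.ofReal t = ∫⁻ _, ENNReal.ofReal t ∂P := by simp
    _ ≤ ∫⁻ ω, ∑ j, (E j).indicator 1 ω ∂P := lintegral_mono ht
    _ = ∑ j, ∫⁻ ω, (E j).indicator 1 ω ∂P :=
      lintegral_finsetSum _ fun j _ => measurable_one.indicator (hE j)
    _ = Fintype.card ι * p := by simp [hE, hp]

/-- Split conformal prediction coverage guarantee: for exchangeable scores
`S_1, …, S_{n+1}`, we have `P[S_{n+1} ≤ Q(1-α, {S_1,…,S_n} ∪ {+∞})] ≥ 1-α`. -/
theorem stmt_0 {Ω : Type*} [MeasurableSpace Ω] (P : Measure Ω) [IsProbabilityMeasure P]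
    (n : ℕ) (hn : 1 ≤ n) (α : ℝ) (hα : α ∈ Set.Ioo (0 : ℝ) 1)
    (S : Fin (n + 1) → Ω → ℝ) (hmeas : ∀ i, Measurable (S i))
    (hexch : ∀ σ : Equiv.Perm (Fin (n + 1)),
      Measure.map (fun ω => fun i => S (σ i) ω) P = Measure.map (fun ω => fun i => S i ω) P) :
    ENNReal.ofReal (1 - α) ≤
      P {ω | (S (Fin.last n) ω : EReal) ≤
        empQuantile α
          ((Finset.univ.val.map fun i : Fin n => ((S i.castSucc ω : ℝ) : EReal)) + {⊤})} := by
  set t : ℝ := (1 - α) * (n + 1)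
  have h_pos : (0 : ℝ) < n + 1 := by positivity
  have h_set (j : Fin (n + 1)) :
      MeasurableSet {x : Fin (n + 1) → ℝ | (strictRank x j : ℝ) < t} :=
    measurableSet_lt (measurable_from_nat.comp (measurable_strictRank j)) measurable_const
  let E (j : Fin (n + 1)) : Set Ω := {ω | (strictRank (fun i => S i ω) j : ℝ) < t}
  have hE (j) : MeasurableSet (E j) := measurable_pi_lambda _ hmeas (h_set j)
  have h_eq (j) : P (E j) = P (E (Fin.last n)) := by
    have h := congrArg (fun μ => μ {x | (strictRank x (Fin.last n) : ℝ) < t})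
      (hexch (Equiv.swap j (Fin.last n)))
    rw [Measure.map_apply (measurable_pi_lambda _ fun i => hmeas _) (h_set _),
      Measure.map_apply (measurable_pi_lambda _ hmeas) (h_set _)] at h
    simpa only [Set.preimage_ofPred_eq, E, Equiv.swap_apply_right,
      fun ω => strictRank_comp_perm (fun i => S i ω) (Equiv.swap j (Fin.last n))] using h
  have h_count (ω : Ω) : ENNReal.ofReal t ≤ ∑ j, (E j).indicator 1 ω := by
    have h := le_card_strictRank_lt (fun i => S i ω) (t := t) (by
      simp only [Fintype.card_fin, Nat.cast_add, Nat.cast_one]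
      nlinarith [hα.1])
    simp only [Set.indicator_apply, Pi.one_apply, E, Set.mem_ofPred_eq, Finset.sum_boole]
    exact ENNReal.ofReal_le_of_le_toReal (by simpa using h)
  have h_main := ofReal_le_card_mul_measure P hE h_eq h_count
  have h_last : ENNReal.ofReal (1 - α) ≤ P (E (Fin.last n)) := by
    rw [ENNReal.ofReal_le_iff_le_toReal (measure_ne_top _ _)]
    rw [ENNReal.ofReal_le_iff_le_toReal (by finiteness), ENNReal.toReal_mul, mul_comm] at h_main
    rw [Fintype.card_fin, ENNReal.toReal_natCast, Nat.cast_add, Nat.cast_one] at h_main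
    exact le_of_mul_le_mul_right (by linarith) h_pos
  exact h_last.trans (measure_mono fun ω hω =>
    le_empQuantile_of_strictRank_lt (fun i => S i ω) hω)
end

section
/- Let n ≥ 1, α ∈ (0,1), let 𝒳 be a measurable space, d ≥ 1, and let (X_1, Y_1), …, (X_{n+1}, Y_{n+1}) be exchangeable random pairs with values in 𝒳 × ℝ^d. Fix a measurable function f : 𝒳 → ℝ^d and define nonconformity scores A_i := ‖Y_i − f(X_i)‖ (Euclidean norm). Let Q := Q(1−α, {A_1, …, A_n} ∪ {+∞}) and define the confidence region Γ^{1−α} := { y ∈ ℝ^d : ‖y − f(X_{n+1})‖ ≤ Q }. Then P[ Y_{n+1} ∈ Γ^{1−α} ] ≥ 1−α. -/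
open MeasureTheory

/-- At least `t` indices have fewer than `t` strictly smaller entries. -/
lemma le_card_filter_card_lt {ι : Type*} [Fintype ι] (b : ι → ℝ) (t : ℝ)
    (ht : t ≤ Fintype.card ι) :
    t ≤ (Finset.univ.filter fun i =>
      ((Finset.univ.filter fun j => b j < b i).card : ℝ) < t).card := by
  by_cases h : ∃ i, t ≤ ((Finset.univ.filter fun j => b j < b i).card : ℝ)
  · obtain ⟨i, hi, hmin⟩ := Finset.exists_min_image
      (Finset.univ.filter fun i => t ≤ ((Finset.univ.filter fun j => b j < b i).card : ℝ)) b
      (by obtain ⟨i, hi⟩ := h; exact ⟨i, by simpa using hi⟩)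
    refine (Finset.mem_filter.1 hi).2.trans (Nat.cast_le.2 (Finset.card_le_card ?_))
    intro j hj
    rw [Finset.mem_filter] at hj ⊢
    refine ⟨Finset.mem_univ _, not_le.1 fun hjt => ?_⟩
    exact (hmin j (Finset.mem_filter.2 ⟨Finset.mem_univ _, hjt⟩)).not_gt hj.2
  · push Not at h
    rwa [Finset.filter_true_of_mem fun i _ => h i, Finset.card_univ]

lemma measurableSet_card_lt {ι : Type*} [Fintype ι] (t : ℝ) (i : ι) :
    MeasurableSet {b : ι → ℝ | ((Finset.univ.filter fun j => b j < b i).card : ℝ) < t} := by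
  refine measurableSet_lt ?_ measurable_const
  simp only [Finset.card_filter, Nat.cast_sum]
  refine Finset.measurable_sum _ fun j _ => ?_
  refine measurable_from_top.comp (Measurable.ite ?_ measurable_const measurable_const)
  exact measurableSet_lt (measurable_pi_apply j) (measurable_pi_apply i)

/-- For an exchangeable law on `ι → ℝ`, a coordinate has fewer than `p * |ι|` strictly smaller
coordinates with probability at least `p`. -/
lemma ofReal_le_measure_card_lt {ι : Type*} [Fintype ι] (ν : Measure (ι → ℝ))
    [IsProbabilityMeasure ν]
    (hν : ∀ σ : Equiv.Perm ι, ν.map (fun b i => b (σ i)) = ν) (p : ℝ) (hp : p ≤ 1) (i : ι) :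
    ENNReal.ofReal p ≤
      ν {b | ((Finset.univ.filter fun j => b j < b i).card : ℝ) < p * Fintype.card ι} := by
  classical
  set t : ℝ := p * Fintype.card ι with ht
  let B : ι → Set (ι → ℝ) := fun i =>
    {b | ((Finset.univ.filter fun j => b j < b i).card : ℝ) < t}
  have hB : ∀ k, MeasurableSet (B k) := measurableSet_card_lt t
  have hcard : (0 : ℝ) < Fintype.card ι := Nat.cast_pos.2 (Fintype.card_pos_iff.2 ⟨i⟩)
  have hperm : ∀ k, ν (B k) = ν (B i) := by
    intro k
    let σ := Equiv.swap i k
    have hm : Measurable fun (b : ι → ℝ) (j : ι) => b (σ j) :=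
      measurable_pi_lambda _ fun j => measurable_pi_apply _
    conv_rhs => rw [← hν σ, Measure.map_apply hm (hB i)]
    congr 1
    ext b
    have hc : (Finset.univ.filter fun j => b (σ j) < b k).card =
        (Finset.univ.filter fun j => b j < b k).card :=
      Finset.card_equiv σ (by simp)
    simp only [B, Set.mem_preimage, Set.mem_ofPred_eq]
    rw [show σ i = k from Equiv.swap_apply_left i k, hc]
  have hsum : ENNReal.ofReal t ≤ ∑ k, ν (B k) := by
    calc ENNReal.ofReal t = ∫⁻ _, ENNReal.ofReal t ∂ν := by simp
      _ ≤ ∫⁻ b, ∑ k, (B k).indicator 1 b ∂ν := by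
        refine lintegral_mono fun b => ?_
        have h := le_card_filter_card_lt b t (by nlinarith)
        have hs : ∑ k, (B k).indicator (1 : (ι → ℝ) → ENNReal) b =
            ((Finset.univ.filter fun k =>
              ((Finset.univ.filter fun j => b j < b k).card : ℝ) < t).card : ENNReal) := by
          simp [B, Set.indicator_apply]
        rw [hs]
        exact ENNReal.ofReal_le_of_le_toReal (by simpa using h)
      _ = ∑ k, ν (B k) := by
        rw [lintegral_finsetSum _ fun k _ => measurable_one.indicator (hB k)]
        simp [hB]
  simp only [hperm, Finset.sum_const, Finset.card_univ, nsmul_eq_mul] at hsum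
  rw [ht, mul_comm, ENNReal.ofReal_mul hcard.le, ENNReal.ofReal_natCast] at hsum
  exact (ENNReal.mul_le_mul_iff_right (by exact_mod_cast hcard.ne') (by simp)).1 hsum

/-- A last entry with few strictly smaller entries is at most the empirical quantile of the
others together with `⊤`. -/
lemma le_empQuantile_of_card_lt {n : ℕ} (α : ℝ) (b : Fin (n + 1) → ℝ)
    (h : ((Finset.univ.filter fun j => b j < b (Fin.last n)).card : ℝ) <
      (1 - α) * Fintype.card (Fin (n + 1))) :
    (b (Fin.last n) : EReal) ≤ empQuantile α
      ((Finset.univ.val.map fun i : Fin n => (b i.castSucc : EReal)) + {⊤}) := by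
  refine le_sInf fun q hq => not_lt.1 fun hlt => ?_
  have hn : (0 : ℝ) < (n : ℝ) + 1 := by positivity
  have htop : ¬ (⊤ : EReal) ≤ q := not_le.2 (hlt.trans_le le_top)
  rw [Set.mem_ofPred_eq, Multiset.filter_add, Multiset.filter_singleton, if_neg htop,
    Multiset.filter_map] at hq
  simp only [Multiset.card_add, Multiset.card_map, Multiset.card_singleton, Finset.card_val,
    Finset.card_univ, Fintype.card_fin, Multiset.empty_eq_zero, add_zero,
    Nat.cast_add, Nat.cast_one] at hq h
  rw [le_div_iff₀ hn] at hq
  refine (h.trans_le hq).not_ge (Nat.cast_le.2 ?_)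
  change (Finset.univ.filter fun i : Fin n => (b i.castSucc : EReal) ≤ q).card ≤ _
  refine Finset.card_le_card_of_injOn Fin.castSucc (fun i hi => ?_)
    (Fin.castSucc_injective n).injOn
  simp only [Finset.coe_filter, Finset.mem_univ, true_and, Set.mem_ofPred_eq] at hi ⊢
  exact EReal.coe_lt_coe_iff.1 (hi.trans_lt hlt)

/-- Validity of the inductive conformal confidence region with nonconformity score
`A_i = ‖Y_i - f(X_i)‖`: with `Q := Q(1-α, {A_1,…,A_n} ∪ {+∞})` and
`Γ := {y : ‖y - f(X_{n+1})‖ ≤ Q}`, we have `P[Y_{n+1} ∈ Γ] ≥ 1-α`. -/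
theorem stmt_2 {Ω : Type*} [MeasurableSpace Ω] (P : Measure Ω) [IsProbabilityMeasure P]
    {𝒳 : Type*} [MeasurableSpace 𝒳]
    (n : ℕ) (hn : 1 ≤ n) (d : ℕ) (hd : 1 ≤ d) (α : ℝ) (hα : α ∈ Set.Ioo (0 : ℝ) 1)
    (X : Fin (n + 1) → Ω → 𝒳) (Y : Fin (n + 1) → Ω → EuclideanSpace ℝ (Fin d))
    (hX : ∀ i, Measurable (X i)) (hY : ∀ i, Measurable (Y i))
    (hexch : ∀ σ : Equiv.Perm (Fin (n + 1)),
      Measure.map (fun ω => fun i => (X (σ i) ω, Y (σ i) ω)) P =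
        Measure.map (fun ω => fun i => (X i ω, Y i ω)) P)
    (f : 𝒳 → EuclideanSpace ℝ (Fin d)) (hf : Measurable f) :
    ENNReal.ofReal (1 - α) ≤
      P {ω | (‖Y (Fin.last n) ω - f (X (Fin.last n) ω)‖ : EReal) ≤
        empQuantile α
          ((Finset.univ.val.map fun i : Fin n =>
            ((‖Y i.castSucc ω - f (X i.castSucc ω)‖ : ℝ) : EReal)) + {⊤})} := by
  have hg : Measurable fun (z : Fin (n + 1) → 𝒳 × EuclideanSpace ℝ (Fin d)) i =>
      ‖(z i).2 - f (z i).1‖ := by fun_prop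
  have hZ : ∀ σ : Equiv.Perm (Fin (n + 1)),
      Measurable fun ω => fun i => (X (σ i) ω, Y (σ i) ω) := fun σ => by fun_prop
  have hZ_id : Measurable fun ω => fun i => (X i ω, Y i ω) := by fun_prop
  have hA : Measurable fun ω => fun i => ‖Y i ω - f (X i ω)‖ := by fun_prop
  obtain ⟨ν, hν_def⟩ : ∃ ν, ν = P.map fun ω => fun i => ‖Y i ω - f (X i ω)‖ := ⟨_, rfl⟩
  have : IsProbabilityMeasure ν := hν_def ▸ Measure.isProbabilityMeasure_map hA.aemeasurable
  have hν : ∀ σ : Equiv.Perm (Fin (n + 1)), ν.map (fun b i => b (σ i)) = ν := by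
    intro σ
    have h := congrArg (Measure.map fun z i => ‖(z i).2 - f (z i).1‖) (hexch σ)
    rw [Measure.map_map hg (hZ σ), Measure.map_map hg hZ_id] at h
    rw [hν_def, Measure.map_map (by fun_prop) hA]
    exact h
  refine (ofReal_le_measure_card_lt ν hν (1 - α) (by linarith [hα.1]) (Fin.last n)).trans ?_
  rw [hν_def, Measure.map_apply hA (measurableSet_card_lt _ _)]
  refine measure_mono fun ω hω => ?_
  rw [Set.mem_preimage, Set.mem_ofPred_eq] at hω
  rw [Set.mem_ofPred_eq]
  exact le_empQuantile_of_card_lt α (fun i => ‖Y i ω - f (X i ω)‖) hω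
end
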